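/- arXiv:math/9811041 — 3 statements merged into one kernel-verified Lean document; each statement's English description precedes it below -/
import Mathlib

section
/- Let n = 2m+1 with m ≥ 0. Then in the polynomial ring ℚ[u,v] one has (n!)² · P_n(u,v) = (u+v+q_m) · ∏_{i=0}^{m−1} [ (u+v+q_i)(u+v+q_{i+1}) + r_i·u ], where q_i = i(n−i) and r_i = (n−1−2i)². -/
open Finset MvPolynomial

/-- Product of left partial sums of a list of parts (as a rational number). -/
noncomputable def Lval (p : List ℕ) : ℚ :=
  ∏ j ∈ Finset.range p.length, (((p.take (j + 1)).sum : ℕ) : ℚ)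

/-- Product of right partial sums. -/
noncomputable def Rval (p : List ℕ) : ℚ := Lval p.reverse

/-- `S k l n`: the sum over all `l`-compositions `p` of `n` of `e_k(p)/(L(p)R(p))`. -/
noncomputable def Sval (k l n : ℕ) : ℚ :=
  ∑ c ∈ Finset.univ.filter (fun c : Composition n => c.length = l),
    ((c.blocks.map (fun i : ℕ => (i : ℚ)) : Multiset ℚ).esymm k) /
      (Lval c.blocks * Rval c.blocks)

/-- The generating polynomial `P_n(u,v)` in `ℚ[u,v]`, with `X 0 = u`, `X 1 = v`. -/
noncomputable def Pgen (n : ℕ) : MvPolynomial (Fin 2) ℚ :=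
  ∑ l ∈ Finset.Icc 1 n, ∑ k ∈ Finset.range (l + 1),
    C (Sval k l n) * X 0 ^ k * X 1 ^ (l - k)

section PowerSeriesODE

variable {K : Type*} [Field K]

/-- The Euler operator `X * d/dX` on power series. -/
noncomputable def eulerOp (f : PowerSeries K) : PowerSeries K :=
  PowerSeries.X * PowerSeries.derivative K f

lemma coeff_eulerOp (f : PowerSeries K) (k : ℕ) :
    PowerSeries.coeff k (eulerOp f) = k * PowerSeries.coeff k f := by
  cases k with
  | zero => simp [eulerOp]
  | succ k =>
    rw [eulerOp, PowerSeries.coeff_succ_X_mul, PowerSeries.coeff_derivative]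
    push_cast
    ring

lemma eulerOp_add (f g : PowerSeries K) : eulerOp (f + g) = eulerOp f + eulerOp g := by
  simp only [eulerOp, map_add]
  ring

lemma eulerOp_mul (f g : PowerSeries K) :
    eulerOp (f * g) = f * eulerOp g + g * eulerOp f := by
  simp only [eulerOp, Derivation.leibniz, smul_eq_mul]
  ring

lemma eulerOp_C_mul (c : K) (f : PowerSeries K) :
    eulerOp (PowerSeries.C c * f) = PowerSeries.C c * eulerOp f := by
  ext k
  simp only [coeff_eulerOp, PowerSeries.coeff_C_mul]
  ring

/-- The binomial series `(1 - X) ^ a`. -/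
noncomputable def oneSubPowSeries (a : K) : PowerSeries K :=
  PowerSeries.mk fun j => ∏ i ∈ range j, ((i : K) - a) / (i + 1)

lemma one_sub_X_mul_eulerOp_oneSubPowSeries [CharZero K] (a : K) :
    (1 - PowerSeries.X) * eulerOp (oneSubPowSeries a) =
      -(PowerSeries.C a * PowerSeries.X * oneSubPowSeries a) := by
  ext k
  cases k with
  | zero => simp [eulerOp]
  | succ k =>
    rw [sub_mul, one_mul, map_sub, PowerSeries.coeff_succ_X_mul, coeff_eulerOp, coeff_eulerOp,
      map_neg, mul_assoc, PowerSeries.coeff_C_mul, PowerSeries.coeff_succ_X_mul]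
    simp only [oneSubPowSeries, PowerSeries.coeff_mk, prod_range_succ]
    have : (k : K) + 1 ≠ 0 := by exact_mod_cast Nat.succ_ne_zero k
    push_cast
    field_simp
    ring

/-- Conjugating the hypergeometric equation by `(1 - X) ^ a`. -/
lemma hypergeometric_conj (ν a v : K) (B Y Q : PowerSeries K)
    (hB : (1 - PowerSeries.X) * eulerOp B = -(PowerSeries.C a * PowerSeries.X * B))
    (hY : eulerOp (eulerOp Y) - PowerSeries.C ν * eulerOp Y =
      PowerSeries.X * (eulerOp (eulerOp Y) + PowerSeries.C (2 * a - ν) * eulerOp Y +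
        PowerSeries.C (a ^ 2 - ν * a - v) * Y) - Q) :
    (1 - PowerSeries.X) ^ 2 * (eulerOp (eulerOp (B * Y)) - PowerSeries.C ν * eulerOp (B * Y)) +
      (PowerSeries.C v * PowerSeries.X * (1 - PowerSeries.X) +
        PowerSeries.C (a - a ^ 2) * PowerSeries.X) * (B * Y) =
      -(Q * (1 - PowerSeries.X) * B) := by
  have hX : eulerOp (1 - PowerSeries.X : PowerSeries K) = -PowerSeries.X := by
    simp [eulerOp]
  have hX' : eulerOp (PowerSeries.X : PowerSeries K) = PowerSeries.X := by
    simp [eulerOp]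
  have hB' := congrArg eulerOp hB
  rw [eulerOp_mul, hX, ← neg_mul, ← neg_mul, ← map_neg, mul_assoc, eulerOp_C_mul, eulerOp_mul,
    hX'] at hB'
  simp only [eulerOp_mul, eulerOp_add]
  simp only [map_sub, map_mul, map_pow, map_neg, map_ofNat] at hY hB' ⊢
  linear_combination (1 - PowerSeries.X) * B * hY +
    hB * ((1 - PowerSeries.X) * (2 * eulerOp Y - PowerSeries.C ν * Y) +
      (PowerSeries.X - PowerSeries.C a * PowerSeries.X) * Y) + (1 - PowerSeries.X) * Y * hB'

/-- The hypergeometric series with lower parameter `1 - n`; its coefficients from index `n` on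
vanish because `x / 0 = 0`. -/
noncomputable def hypSeries (n : ℕ) (a v : K) : PowerSeries K :=
  PowerSeries.mk fun k =>
    ∏ i ∈ range k, ((a + i) ^ 2 - n * (a + i) - v) / (((i : K) + 1) * (i + 1 - n))

lemma hypSeries_ode [CharZero K] (m : ℕ) (a v : K) :
    eulerOp (eulerOp (hypSeries (m + 1) a v)) -
        PowerSeries.C ((m + 1 : ℕ) : K) * eulerOp (hypSeries (m + 1) a v) =
      PowerSeries.X * (eulerOp (eulerOp (hypSeries (m + 1) a v)) +
        PowerSeries.C (2 * a - (m + 1 : ℕ)) * eulerOp (hypSeries (m + 1) a v) +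
        PowerSeries.C (a ^ 2 - (m + 1 : ℕ) * a - v) * hypSeries (m + 1) a v) -
      PowerSeries.C (((a + m) ^ 2 - (m + 1 : ℕ) * (a + m) - v) *
        PowerSeries.coeff m (hypSeries (m + 1) a v)) * PowerSeries.X ^ (m + 1) := by
  ext k
  cases k with
  | zero => simp [eulerOp]
  | succ k =>
    simp only [map_sub, map_add, PowerSeries.coeff_succ_X_mul, coeff_eulerOp,
      PowerSeries.coeff_C_mul, PowerSeries.coeff_X_pow]
    have h1 : (k : K) + 1 ≠ 0 := by exact_mod_cast Nat.succ_ne_zero k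
    by_cases hk : k = m
    · subst hk
      simp only [if_true]
      simp only [sub_mul, PowerSeries.coeff_C_mul, map_sub, coeff_eulerOp]
      push_cast
      ring
    · have h2 : (k : K) - m ≠ 0 := sub_ne_zero.2 (by exact_mod_cast hk)
      have h3 : (k : K) + 1 - (m + 1) ≠ 0 := by convert h2 using 1; ring
      rw [if_neg (by omega)]
      have : PowerSeries.coeff (k + 1) (hypSeries (m + 1) a v) =
          PowerSeries.coeff k (hypSeries (m + 1) a v) *
            (((a + k) ^ 2 - (m + 1 : ℕ) * (a + k) - v) /
              (((k : K) + 1) * (k + 1 - (m + 1 : ℕ)))) := by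
        simp only [hypSeries, PowerSeries.coeff_mk, prod_range_succ]
      rw [this]
      simp only [sub_mul, PowerSeries.coeff_C_mul, map_sub, coeff_eulerOp]
      push_cast
      field_simp
      ring

lemma constantCoeff_oneSubPowSeries (a : K) :
    PowerSeries.constantCoeff (oneSubPowSeries a) = 1 := by
  rw [← PowerSeries.coeff_zero_eq_constantCoeff_apply, oneSubPowSeries, PowerSeries.coeff_mk,
    prod_range_zero]

lemma constantCoeff_hypSeries (n : ℕ) (a v : K) :
    PowerSeries.constantCoeff (hypSeries n a v) = 1 := by
  rw [← PowerSeries.coeff_zero_eq_constantCoeff_apply, hypSeries, PowerSeries.coeff_mk,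
    prod_range_zero]

lemma coeff_geom_mul (u v : K) (G : PowerSeries K) (k : ℕ) :
    PowerSeries.coeff k ((PowerSeries.C v * PowerSeries.X * PowerSeries.mk 1 +
      PowerSeries.C u * PowerSeries.X * PowerSeries.mk 1 ^ 2) * G) =
      ∑ i ∈ range k, (v + ((k : K) - i) * u) * PowerSeries.coeff i G := by
  have hW : (PowerSeries.C v * PowerSeries.X * PowerSeries.mk 1 +
      PowerSeries.C u * PowerSeries.X * PowerSeries.mk 1 ^ 2 : PowerSeries K) =
      PowerSeries.X * PowerSeries.mk fun j => v + ((j : K) + 1) * u := by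
    have : (PowerSeries.mk 1 : PowerSeries K) ^ 2 = PowerSeries.mk fun j => (j : K) + 1 := by
      ext j
      rw [PowerSeries.mk_one_pow_eq_mk_choose_add K 1]
      simp [add_comm]
    rw [this]
    ext j
    cases j with
    | zero => simp
    | succ j =>
      simp only [mul_assoc, map_add, PowerSeries.coeff_C_mul, PowerSeries.coeff_succ_X_mul,
        PowerSeries.coeff_mk, Pi.one_apply]
      ring
  rw [hW, mul_assoc]
  cases k with
  | zero => simp
  | succ k =>
    rw [PowerSeries.coeff_succ_X_mul, mul_comm, PowerSeries.coeff_mul,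
      Finset.Nat.sum_antidiagonal_eq_sum_range_succ
        (fun i j => PowerSeries.coeff i G *
          PowerSeries.coeff j (PowerSeries.mk fun j => v + ((j : K) + 1) * u))]
    refine sum_congr rfl fun i hi => ?_
    rw [PowerSeries.coeff_mk, Nat.cast_sub (by simpa [Nat.lt_succ_iff] using hi)]
    push_cast
    ring

/-- The coefficients of `(1 - X) ^ a` times the hypergeometric series solve the linear recurrence
satisfied by the composition sums. -/
lemma coeff_oneSubPow_mul_hypSeries [CharZero K] (m : ℕ) (a v : K) (k : ℕ) :
    (k : K) * (k - (m + 1 : ℕ)) * PowerSeries.coeff k (oneSubPowSeries a * hypSeries (m + 1) a v) +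
      ∑ i ∈ range k, (v + ((k : K) - i) * (a - a ^ 2)) *
        PowerSeries.coeff i (oneSubPowSeries a * hypSeries (m + 1) a v) =
    -(((a + m) ^ 2 - (m + 1 : ℕ) * (a + m) - v) *
        PowerSeries.coeff m (hypSeries (m + 1) a v) *
      PowerSeries.coeff k (PowerSeries.X ^ (m + 1) * (oneSubPowSeries a * PowerSeries.mk 1))) := by
  have hI := PowerSeries.mk_one_mul_one_sub_eq_one K
  have h := hypergeometric_conj _ a v _ _ _ (one_sub_X_mul_eulerOp_oneSubPowSeries a)
    (hypSeries_ode m a v)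
  set δ := ((a + m) ^ 2 - (m + 1 : ℕ) * (a + m) - v) *
        PowerSeries.coeff m (hypSeries (m + 1) a v)
  set G := oneSubPowSeries a * hypSeries (m + 1) a v
  set I : PowerSeries K := PowerSeries.mk 1
  have h' : eulerOp (eulerOp G) - PowerSeries.C ((m + 1 : ℕ) : K) * eulerOp G +
      (PowerSeries.C v * PowerSeries.X * I +
        PowerSeries.C (a - a ^ 2) * PowerSeries.X * I ^ 2) * G =
      PowerSeries.C (-δ) * (PowerSeries.X ^ (m + 1) * (oneSubPowSeries a * I)) := by
    have hI2 : I ^ 2 * (1 - PowerSeries.X) ^ 2 = 1 := by rw [← mul_pow, hI, one_pow]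
    have hI3 : I ^ 2 * (1 - PowerSeries.X) = I := by rw [pow_two, mul_assoc, hI, mul_one]
    rw [map_neg]
    linear_combination I ^ 2 * h -
      (eulerOp (eulerOp G) - PowerSeries.C ((m + 1 : ℕ) : K) * eulerOp G) * hI2 -
      (PowerSeries.C v * PowerSeries.X * G +
        PowerSeries.C δ * PowerSeries.X ^ (m + 1) * oneSubPowSeries a) * hI3
  have hk := congrArg (PowerSeries.coeff k) h'
  rw [map_add, coeff_geom_mul, map_sub, PowerSeries.coeff_C_mul, PowerSeries.coeff_C_mul,
    coeff_eulerOp, coeff_eulerOp] at hk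
  linear_combination hk

/-- Closed form for the last term of a sequence solving the recurrence of the composition sums. -/
lemma recurrence_closed_form [CharZero K] (m : ℕ) (a v : K) (S : ℕ → K) (h0 : S 0 = 1)
    (hS : ∀ k, 0 < k → k ≤ m + 1 → (k : K) * S k =
      ∑ i ∈ range k, (v + ((k : K) - i) * (a - a ^ 2)) * (S i / ((m + 1 : ℕ) - i))) :
    ((m + 1).factorial : K) ^ 2 * S (m + 1) =
      (-1) ^ (m + 1) * ∏ i ∈ range (m + 1), ((a + i) ^ 2 - (m + 1 : ℕ) * (a + i) - v) := by
  have hrec := coeff_oneSubPow_mul_hypSeries m a v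
  set G := oneSubPowSeries a * hypSeries (m + 1) a v with hG
  have hm : ((m + 1 : ℕ) : K) ≠ 0 := by exact_mod_cast Nat.succ_ne_zero m
  have hGS : ∀ k, k < m + 1 →
      (m + 1 : ℕ) * (S k / ((m + 1 : ℕ) - k)) = PowerSeries.coeff k G := by
    intro k
    induction k using Nat.strong_induction_on with
    | _ k ih =>
      intro hk
      rcases Nat.eq_zero_or_pos k with rfl | hpos
      · rw [PowerSeries.coeff_zero_eq_constantCoeff_apply, hG, map_mul,
          constantCoeff_oneSubPowSeries, constantCoeff_hypSeries, h0, Nat.cast_zero, sub_zero,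
          mul_one_div_cancel hm, mul_one]
      · have hk0 : (k : K) ≠ 0 := by exact_mod_cast hpos.ne'
        have hkm : ((m + 1 : ℕ) : K) - k ≠ 0 := sub_ne_zero.2 (by exact_mod_cast hk.ne')
        have h1 := hrec k
        rw [PowerSeries.coeff_X_pow_mul', if_neg (by omega)] at h1
        have h2 := hS k hpos hk.le
        have h3 : ∑ i ∈ range k, (v + ((k : K) - i) * (a - a ^ 2)) * PowerSeries.coeff i G =
            (m + 1 : ℕ) * (k * S k) := by
          rw [h2, mul_sum]
          refine sum_congr rfl fun i hi => ?_
          rw [← ih i (mem_range.1 hi) ((mem_range.1 hi).trans hk)]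
          ring
        rw [h3] at h1
        rw [← mul_div_assoc, div_eq_iff hkm]
        apply mul_left_cancel₀ hk0
        linear_combination h1
  have hlast := hrec (m + 1)
  rw [PowerSeries.coeff_X_pow_mul', if_pos le_rfl, Nat.sub_self] at hlast
  have hc : PowerSeries.coeff 0 (oneSubPowSeries a * PowerSeries.mk 1) = 1 := by
    rw [PowerSeries.coeff_zero_eq_constantCoeff_apply, map_mul, constantCoeff_oneSubPowSeries,
      one_mul, ← PowerSeries.coeff_zero_eq_constantCoeff_apply, PowerSeries.coeff_mk, Pi.one_apply]
  have h3 : ∑ i ∈ range (m + 1), (v + (((m + 1 : ℕ) : K) - i) * (a - a ^ 2)) *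
      PowerSeries.coeff i G = (m + 1 : ℕ) * ((m + 1 : ℕ) * S (m + 1)) := by
    rw [hS (m + 1) m.succ_pos le_rfl, mul_sum]
    refine sum_congr rfl fun i hi => ?_
    rw [← hGS i (mem_range.1 hi)]
    ring
  have hden : ∏ i ∈ range m, (((i : K) + 1) * (i + 1 - (m + 1 : ℕ))) =
      (-1) ^ m * (m.factorial : K) ^ 2 := by
    have e1 : ∏ i ∈ range m, ((i : K) + 1) = m.factorial := by
      rw [← Finset.prod_range_add_one_eq_factorial]
      push_cast
      rfl
    have e2 : ∏ i ∈ range m, ((i : K) + 1 - (m + 1 : ℕ)) = (-1) ^ m * m.factorial := by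
      rw [← e1, ← Finset.prod_range_reflect (fun i : ℕ => (i : K) + 1), ← card_range m,
        ← prod_const, card_range, ← prod_mul_distrib]
      refine prod_congr rfl fun i hi => ?_
      have := mem_range.1 hi
      rw [Nat.sub_sub, Nat.cast_sub (by omega)]
      push_cast
      ring
    rw [prod_mul_distrib, e1, e2]
    ring
  have hcoeff : (m.factorial : K) ^ 2 * PowerSeries.coeff m (hypSeries (m + 1) a v) =
      (-1) ^ m * ∏ i ∈ range m, ((a + i) ^ 2 - (m + 1 : ℕ) * (a + i) - v) := by
    have hf : (m.factorial : K) ≠ 0 := by exact_mod_cast m.factorial_ne_zero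
    rw [hypSeries, PowerSeries.coeff_mk, prod_div_distrib, hden]
    have hs0 : ((-1 : K) ^ m) ≠ 0 := by simp
    field_simp
    rw [pow_right_comm]
    simp
  rw [h3, hc] at hlast
  rw [prod_range_succ, Nat.factorial_succ]
  push_cast at hlast hcoeff ⊢
  rw [pow_succ]
  linear_combination (m.factorial : K) ^ 2 * hlast -
    ((a + m) ^ 2 - (m + 1 : K) * (a + m) - v) * hcoeff

end PowerSeriesODE

section CompositionSums

lemma sum_composition_blocks_cons {M : Type*} [AddCommMonoid M] (F : List ℕ → M) {k : ℕ}
    (hk : 0 < k) :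
    ∑ c : Composition k, F c.blocks =
      ∑ i ∈ range k, ∑ c : Composition i, F ((k - i) :: c.blocks) := by
  rw [sum_sigma']
  symm
  refine sum_bij (fun x hx => (⟨(k - x.1) :: x.2.blocks, ?_, ?_⟩ : Composition k)) ?_ ?_ ?_ ?_
  · intro i hi
    have := mem_range.1 (mem_sigma.1 hx).1
    rcases List.mem_cons.1 hi with rfl | hi
    · omega
    · exact x.2.blocks_pos hi
  · have := mem_range.1 (mem_sigma.1 hx).1
    rw [List.sum_cons, x.2.blocks_sum]
    omega
  · intros
    exact mem_univ _
  · rintro ⟨i, c⟩ hx ⟨j, d⟩ hy h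
    have h' : (k - i) :: c.blocks = (k - j) :: d.blocks := congrArg Composition.blocks h
    obtain ⟨-, h2⟩ := List.cons.inj h'
    obtain rfl : i = j := by rw [← c.blocks_sum, h2, d.blocks_sum]
    obtain rfl : c = d := Composition.ext h2
    rfl
  · rintro ⟨bl, hpos, hsum⟩ -
    cases bl with
    | nil => simp at hsum; omega
    | cons p ps =>
      rw [List.sum_cons] at hsum
      have hp : 0 < p := hpos (List.mem_cons_self)
      refine ⟨⟨ps.sum, ⟨ps, fun hi => hpos (List.mem_cons_of_mem _ hi), rfl⟩⟩, ?_, ?_⟩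
      · simp
        omega
      · apply Composition.ext
        have : k - ps.sum = p := by omega
        simp [this]
  · intros
    rfl

variable {K : Type*} [Field K]

/-- The weight of a list of parts, peeling off the first part; `n` plays the role of the total. -/
def partsWeight (n : ℕ) (f : ℕ → K) : List ℕ → K
  | [] => 1
  | p :: ps => f p / ((n - ps.sum) * (p + ps.sum)) * partsWeight n f ps

lemma partsWeight_eq (n : ℕ) (f : ℕ → K) (p : List ℕ) :
    partsWeight n f p = (p.map f).prod /
      ((∏ j ∈ range p.length, ((n : K) - (p.drop (j + 1)).sum)) *
        ∏ j ∈ range p.length, (((p.drop j).sum : ℕ) : K)) := by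
  induction p with
  | nil => simp [partsWeight]
  | cons p ps ih =>
    rw [partsWeight, ih, List.length_cons, prod_range_succ', prod_range_succ']
    simp only [List.drop_succ_cons, List.map_cons, List.prod_cons, List.drop_zero, List.sum_cons,
      Nat.cast_add, div_mul_div_comm]
    congr 1
    ring

lemma sum_partsWeight_recurrence [CharZero K] (n : ℕ) (f : ℕ → K) {k : ℕ} (hk : 0 < k) :
    (k : K) * ∑ c : Composition k, partsWeight n f c.blocks =
      ∑ i ∈ range k, f (k - i) * ((∑ c : Composition i, partsWeight n f c.blocks) / (n - i)) := by
  rw [sum_composition_blocks_cons _ hk, mul_sum]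
  refine sum_congr rfl fun i hi => ?_
  have hik := mem_range.1 hi
  have hk0 : (k : K) ≠ 0 := by exact_mod_cast hk.ne'
  rw [sum_div, mul_sum, mul_sum]
  refine sum_congr rfl fun c _ => ?_
  have hcast : (((k - i : ℕ) : K) + (i : K)) = k := by
    rw [Nat.cast_sub hik.le]
    ring
  rw [partsWeight, c.blocks_sum, hcast, div_mul_eq_div_div_swap]
  field_simp

lemma Lval_eq_prod_drop (p : List ℕ) :
    Lval p = ∏ j ∈ range p.length, ((p.sum : ℚ) - (p.drop (j + 1)).sum) := by
  refine prod_congr rfl fun j _ => ?_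
  rw [← List.sum_take_add_sum_drop p (j + 1)]
  push_cast
  ring

lemma Rval_eq_prod_drop (p : List ℕ) :
    Rval p = ∏ j ∈ range p.length, (((p.drop j).sum : ℕ) : ℚ) := by
  rw [Rval, Lval, List.length_reverse, ← prod_range_reflect]
  refine prod_congr rfl fun j hj => ?_
  have := mem_range.1 hj
  rw [List.take_reverse, List.sum_reverse]
  congr 3
  omega

lemma prod_map_div_LR_eq_partsWeight [CharZero K] {n : ℕ} (f : ℕ → K) (c : Composition n) :
    (c.blocks.map f).prod / ((Lval c.blocks * Rval c.blocks : ℚ) : K) =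
      partsWeight n f c.blocks := by
  rw [partsWeight_eq, Lval_eq_prod_drop, Rval_eq_prod_drop, c.blocks_sum]
  simp only [Rat.cast_mul, Rat.cast_prod, Rat.cast_sub, Rat.cast_natCast]

/-- Homogeneous Vieta formula for a list of natural numbers. -/
lemma sum_esymm_mul_pow [CharZero K] (u v : K) (p : List ℕ) :
    ∑ k ∈ range (p.length + 1),
      (((p.map (fun i : ℕ => (i : ℚ)) : Multiset ℚ).esymm k : ℚ) : K) * u ^ k *
        v ^ (p.length - k) = (p.map fun i : ℕ => v + (i : K) * u).prod := by
  have hcast (k : ℕ) : (((p.map (fun i : ℕ => (i : ℚ)) : Multiset ℚ).esymm k : ℚ) : K) =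
      (p.map (fun i : ℕ => (i : K)) : Multiset K).esymm k := by
    have : (p.map (fun i : ℕ => (i : K)) : Multiset K) =
        (p.map (fun i : ℕ => (i : ℚ)) : Multiset ℚ).map (Rat.castHom K) := by
      simp [Function.comp_def]
    rw [this, Multiset.esymm, Multiset.esymm, Multiset.powersetCard_map, Multiset.map_map,
      ← Rat.coe_castHom, map_multiset_sum, Multiset.map_map]
    congr 1
    refine Multiset.map_congr rfl fun s _ => ?_
    simp
  have h := congrArg (Polynomial.eval v)
    (Multiset.prod_X_add_C_eq_sum_esymm ((p.map (fun i : ℕ => (i : K)) : Multiset K).map (u • ·)))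
  simp only [Polynomial.eval_finsetSum, Polynomial.eval_mul, Polynomial.eval_pow,
    Polynomial.eval_X, Polynomial.eval_C, ← Multiset.pow_smul_esymm, Multiset.card_map,
    Multiset.coe_card, List.length_map, Polynomial.eval_multiset_prod, Multiset.map_map] at h
  simp only [hcast]
  rw [Finset.sum_congr rfl fun k _ => by
    rw [mul_comm (Multiset.esymm _ _) (u ^ k), ← smul_eq_mul (u ^ k)], ← h]
  simp [Function.comp_def, mul_comm]

lemma eval₂Hom_Pgen [CharZero K] {n : ℕ} (hn : 0 < n) (x : Fin 2 → K) :
    eval₂Hom (Rat.castHom K) x (Pgen n) =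
      ∑ c : Composition n, partsWeight n (fun i => x 1 + (i : K) * x 0) c.blocks := by
  rw [← sum_fiberwise_of_maps_to (s := univ) (t := Icc 1 n) (g := Composition.length)
    fun c _ => mem_Icc.2 ⟨c.length_pos_of_pos hn, c.length_le⟩]
  simp only [Pgen, map_sum, map_mul, map_pow, coe_eval₂Hom, eval₂_C, eval₂_X, Sval]
  refine sum_congr rfl fun l _ => ?_
  simp only [sum_mul]
  rw [sum_comm]
  refine sum_congr rfl fun c hc => ?_
  obtain rfl : c.length = l := (mem_filter.1 hc).2
  rw [← prod_map_div_LR_eq_partsWeight, ← sum_esymm_mul_pow, sum_div]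
  refine sum_congr rfl fun k _ => ?_
  rw [map_div₀]
  simp only [Rat.coe_castHom]
  rw [div_mul_eq_mul_div, div_mul_eq_mul_div]

end CompositionSums

/-- Pairing the factors of index `i` and `2 * m - i` eliminates the root `a` of `a - a ^ 2 = u`. -/
lemma prod_pairing {K : Type*} [Field K] (m : ℕ) (a v : K) :
    (-1) ^ (2 * m + 1) * ∏ i ∈ range (2 * m + 1),
        ((a + i) ^ 2 - (2 * m + 1 : ℕ) * (a + i) - v) =
      ((a - a ^ 2) + v + m * ((2 * m + 1 : ℕ) - m)) *
        ∏ i ∈ range m, (((a - a ^ 2) + v + i * ((2 * m + 1 : ℕ) - i)) *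
          ((a - a ^ 2) + v + (i + 1 : ℕ) * ((2 * m + 1 : ℕ) - (i + 1 : ℕ))) +
          ((2 * m + 1 : ℕ) - 1 - 2 * i) ^ 2 * (a - a ^ 2)) := by
  have hsplit : ∏ i ∈ range (2 * m + 1), ((a + i) ^ 2 - (2 * m + 1 : ℕ) * (a + i) - v) =
      (∏ i ∈ range m, ((a + i) ^ 2 - (2 * m + 1 : ℕ) * (a + i) - v)) *
      ((a + m) ^ 2 - (2 * m + 1 : ℕ) * (a + m) - v) *
      ∏ i ∈ range m, ((a + (2 * m - i : K)) ^ 2 - (2 * m + 1 : ℕ) * (a + (2 * m - i : K)) - v) := by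
    rw [show 2 * m + 1 = (m + 1) + m by ring, prod_range_add, prod_range_succ]
    congr 1
    rw [← prod_range_reflect]
    refine prod_congr rfl fun i hi => ?_
    have := mem_range.1 hi
    have e : ((m + 1 + (m - 1 - i) : ℕ) : K) = 2 * m - i := by
      rw [show m + 1 + (m - 1 - i) = 2 * m - i by omega, Nat.cast_sub (by omega)]
      push_cast
      ring
    rw [e]
  have hsign : (-1 : K) ^ (2 * m + 1) = -1 := Odd.neg_one_pow ⟨m, rfl⟩
  rw [hsplit, hsign, mul_right_comm, ← prod_mul_distrib, mul_comm _ (_ - v), ← mul_assoc]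
  congr 1
  · push_cast
    ring
  · refine prod_congr rfl fun i _ => ?_
    push_cast
    ring

/-- Odd case of the factorization theorem: for `n = 2m+1`, `m ≥ 0`,
`(n!)² ⬝ P_n(u,v) = (u+v+q_m) ∏_{i=0}^{m-1} [(u+v+q_i)(u+v+q_{i+1}) + r_i u]`
where `q_i = i(n-i)` and `r_i = (n-1-2i)²`. -/
theorem composition_sum_factorization_odd (m : ℕ) (n : ℕ) (hn : n = 2 * m + 1)
    (q r : ℕ → MvPolynomial (Fin 2) ℚ)
    (hq : ∀ i, q i = C ((i : ℚ) * ((n : ℚ) - i)))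
    (hr : ∀ i, r i = C (((n : ℚ) - 1 - 2 * i) ^ 2)) :
    (((n.factorial : ℚ) ^ 2) • Pgen n : MvPolynomial (Fin 2) ℚ) =
      (X 0 + X 1 + q m) *
        ∏ i ∈ Finset.range m,
          ((X 0 + X 1 + q i) * (X 0 + X 1 + q (i + 1)) + r i * X 0) := by
  subst hn
  apply map_injective (Rat.castHom ℂ) (Rat.castHom ℂ).injective
  refine MvPolynomial.funext fun x => ?_
  simp only [eval_map, ← coe_eval₂Hom]
  obtain ⟨a, ha⟩ : ∃ a : ℂ, a - a ^ 2 = x 0 := by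
    obtain ⟨s, hs⟩ := IsAlgClosed.exists_pow_nat_eq (1 - 4 * x 0) (n := 2) two_pos
    exact ⟨(1 + s) / 2, by linear_combination -hs / 4⟩
  have key := recurrence_closed_form (2 * m) a (x 1)
    (fun k => ∑ c : Composition k,
      partsWeight (2 * m + 1) (fun i => x 1 + (i : ℂ) * x 0) c.blocks)
    (by simp [(Composition.blocks_eq_nil _).2 rfl, partsWeight, composition_card])
    (fun k hk _ => by
      rw [sum_partsWeight_recurrence _ _ hk]
      refine sum_congr rfl fun i hi => ?_
      rw [Nat.cast_sub (mem_range.1 hi).le, ha])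
  rw [smul_eq_C_mul, map_mul, eval₂Hom_Pgen (Nat.succ_pos _)]
  simp only [hq, hr, map_mul, map_add, map_prod, coe_eval₂Hom, eval₂_C, eval₂_X]
  have hfac : (Rat.castHom ℂ) (((2 * m + 1).factorial : ℚ) ^ 2) =
      ((2 * m + 1).factorial : ℂ) ^ 2 := by simp
  rw [hfac, key, prod_pairing, ha]
  simp
end

section
/- Let n ≥ 2, let m = ⌊n/2⌋, and let 1 ≤ l ≤ n. Then the sum over all l-compositions p = (p_1,…,p_l) of n of (p_1−1)(p_2−1)⋯(p_l−1)/(L(p)·R(p)) equals ((n−1)/n²) · e_{l−1}( r_1/(q_1 q_2), r_2/(q_2 q_3), …, r_{m−1}/(q_{m−1} q_m) ), where q_i = i(n−i), r_i = (n−1−2i)², and e_{l−1} is the (l−1)-st elementary symmetric polynomial evaluated at the m−1 listed rational numbers (interpreted as 0 when l−1 > m−1, and as 1 when l = 1). -/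
open Finset MvPolynomial

lemma prod_range_eq_prod_range_half (u v : ℕ → ℚ) (k : ℕ)
    (h : ∀ i < k, u i * u (k - 1 - i) = v i) (hmid : ∀ i, k = 2 * i + 1 → u i = 1) :
    ∏ i ∈ range k, u i = ∏ i ∈ range (k / 2), v i := by
  have key : ∀ a b : ℕ, k = a + b → a = k / 2 →
      ∏ i ∈ range a, u (b + i) = ∏ i ∈ range a, u (k - 1 - i) := by
    intro a b hk _
    rw [← prod_range_reflect]
    refine prod_congr rfl fun i hi => ?_
    have := mem_range.1 hi
    congr 1
    lia
  have hv : ∏ i ∈ range (k / 2), v i =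
      (∏ i ∈ range (k / 2), u i) * ∏ i ∈ range (k / 2), u (k - 1 - i) := by
    rw [← prod_mul_distrib]
    exact prod_congr rfl fun i hi => (h i (by have := mem_range.1 hi; lia)).symm
  obtain ⟨a, ha | ha⟩ := Nat.even_or_odd' k
  · rw [hv, ← key (k / 2) (k / 2) (by lia) rfl, ← prod_range_add]
    congr 2; lia
  · rw [hv, ← key (k / 2) (k / 2 + 1) (by lia) rfl]
    have : ∏ i ∈ range (k / 2), u i = ∏ i ∈ range (k / 2 + 1), u i := by
      rw [prod_range_succ, hmid (k / 2) (by lia), mul_one]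
    rw [this, ← prod_range_add]
    congr 2; lia

lemma coeff_prod_one_add_C_mul_X {ι : Type*} (s : Finset ι) (a : ι → ℚ) (k : ℕ) :
    (∏ i ∈ s, (1 + Polynomial.C (a i) * Polynomial.X)).coeff k = (s.val.map a).esymm k := by
  classical
  rw [prod_one_add, Finset.esymm_map_val, Polynomial.finsetSum_coeff,
    powersetCard_eq_filter, sum_filter]
  refine sum_congr rfl fun t _ => ?_
  rw [prod_mul_distrib, prod_const, ← map_prod, Polynomial.coeff_C_mul_X_pow]
  simp [eq_comm]

section
open scoped PowerSeries

lemma coeff_second_difference (F : ℚ⟦X⟧) (k : ℕ) :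
    PowerSeries.coeff k ((1 - PowerSeries.X) ^ 2 * F) =
      PowerSeries.coeff (k + 2) (PowerSeries.X ^ 2 * F) -
        2 * PowerSeries.coeff (k + 1) (PowerSeries.X ^ 2 * F) +
        PowerSeries.coeff k (PowerSeries.X ^ 2 * F) := by
  have : (PowerSeries.X ^ 2 * ((1 - PowerSeries.X) ^ 2 * F) : ℚ⟦X⟧) =
      PowerSeries.X ^ 2 * F - 2 * (PowerSeries.X * (PowerSeries.X ^ 2 * F)) +
        PowerSeries.X ^ 2 * (PowerSeries.X ^ 2 * F) := by ring
  have h2 := congrArg (PowerSeries.coeff (k + 2)) this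
  have e2 : (2 : ℚ⟦X⟧) = PowerSeries.C 2 := (map_ofNat PowerSeries.C 2).symm
  rw [e2] at h2
  simp only [map_sub, map_add, PowerSeries.coeff_X_pow_mul, PowerSeries.coeff_C_mul,
    PowerSeries.coeff_succ_X_mul] at h2 ⊢
  exact h2

lemma coeff_X_mul_derivative (F : ℚ⟦X⟧) (k : ℕ) :
    PowerSeries.coeff k (PowerSeries.X * d⁄dX ℚ F) = k * PowerSeries.coeff k F := by
  cases k with
  | zero => simp
  | succ k => rw [PowerSeries.coeff_succ_X_mul, PowerSeries.coeff_derivative, mul_comm]; simp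

lemma coeff_X_sq_mul_derivative_derivative (F : ℚ⟦X⟧) (k : ℕ) :
    PowerSeries.coeff k (PowerSeries.X ^ 2 * d⁄dX ℚ (d⁄dX ℚ F)) =
      k * (k - 1) * PowerSeries.coeff k F := by
  have h : PowerSeries.X ^ 2 * d⁄dX ℚ (d⁄dX ℚ F) =
      PowerSeries.X * d⁄dX ℚ (PowerSeries.X * d⁄dX ℚ F) - PowerSeries.X * d⁄dX ℚ F := by
    rw [Derivation.leibniz, PowerSeries.derivative_X]
    simp only [smul_eq_mul]
    ring
  rw [h, map_sub, coeff_X_mul_derivative, coeff_X_mul_derivative]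
  ring

lemma coeff_euler (p : ℚ) (W : ℚ⟦X⟧) (k : ℕ) :
    PowerSeries.coeff k (PowerSeries.C p * (PowerSeries.X * d⁄dX ℚ W) -
      PowerSeries.X ^ 2 * d⁄dX ℚ (d⁄dX ℚ W)) = k * (p + 1 - k) * PowerSeries.coeff k W := by
  rw [map_sub, PowerSeries.coeff_C_mul, coeff_X_mul_derivative,
    coeff_X_sq_mul_derivative_derivative]
  ring

lemma euler_mul_pow (p : ℚ) (M : ℕ) (H : ℚ⟦X⟧) :
    PowerSeries.C p * (PowerSeries.X * d⁄dX ℚ ((1 - PowerSeries.X) ^ (M + 2) * H)) -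
        PowerSeries.X ^ 2 * d⁄dX ℚ (d⁄dX ℚ ((1 - PowerSeries.X) ^ (M + 2) * H)) +
        (((M : ℚ⟦X⟧) + 2) * ((M : ℚ⟦X⟧) + 1)) * (PowerSeries.X ^ 2 * ((1 - PowerSeries.X) ^ M * H)) =
      PowerSeries.X * (1 - PowerSeries.X) ^ (M + 1) *
        (PowerSeries.C p * ((1 - PowerSeries.X) * d⁄dX ℚ H - ((M : ℚ⟦X⟧) + 2) * H) -
          PowerSeries.X * (1 - PowerSeries.X) * d⁄dX ℚ (d⁄dX ℚ H) +
          2 * ((M : ℚ⟦X⟧) + 2) * (PowerSeries.X * d⁄dX ℚ H)) := by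
  have hd (j : ℕ) (G : ℚ⟦X⟧) : d⁄dX ℚ ((1 - PowerSeries.X) ^ (j + 1) * G) =
      (1 - PowerSeries.X : ℚ⟦X⟧) ^ j * ((1 - PowerSeries.X) * d⁄dX ℚ G - ((j : ℚ⟦X⟧) + 1) * G) := by
    rw [Derivation.leibniz, Derivation.leibniz_pow]
    simp
    ring
  rw [hd, hd]
  simp only [map_sub, Derivation.leibniz, map_add]
  simp
  ring

/-- Coefficients of the truncated hypergeometric series `₂F₁(ρ + a, ρ + b; -p; x)` with `ρ = M + 2`,
`a + b = -(p + 1)` and `a * b = ρ * (1 - ρ)`; division by zero makes them vanish beyond index `p`. -/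
noncomputable def hypCoeff (p M k : ℕ) : ℚ :=
  ∏ j ∈ range k, (j * ((p : ℚ) + 1 - j) - (M + 2) * (2 * j - p)) / ((j + 1) * (p - j))

lemma hypCoeff_succ (p M k : ℕ) (hk : k ≠ p) :
    ((k : ℚ) + 1) * (p - k) * hypCoeff p M (k + 1) =
      (k * ((p : ℚ) + 1 - k) - (M + 2) * (2 * k - p)) * hypCoeff p M k := by
  rw [hypCoeff, prod_range_succ, ← hypCoeff]
  have h1 : (p : ℚ) - k ≠ 0 := sub_ne_zero.2 (by exact_mod_cast hk.symm)
  have h2 : (k : ℚ) + 1 ≠ 0 := by positivity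
  field_simp

lemma hypergeometric_equation (p M : ℕ) :
    PowerSeries.C (p : ℚ) * ((1 - PowerSeries.X) * d⁄dX ℚ (PowerSeries.mk (hypCoeff p M)) -
          ((M : ℚ⟦X⟧) + 2) * PowerSeries.mk (hypCoeff p M)) -
        PowerSeries.X * (1 - PowerSeries.X) * d⁄dX ℚ (d⁄dX ℚ (PowerSeries.mk (hypCoeff p M))) +
        2 * ((M : ℚ⟦X⟧) + 2) * (PowerSeries.X * d⁄dX ℚ (PowerSeries.mk (hypCoeff p M))) =
      PowerSeries.C (p * (M + 1) * hypCoeff p M p) * PowerSeries.X ^ p := by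
  set H : ℚ⟦X⟧ := PowerSeries.mk (hypCoeff p M) with hH
  have hM : (M : ℚ⟦X⟧) + 2 = PowerSeries.C ((M : ℚ) + 2) := by
    rw [map_add, map_natCast, map_ofNat]
  have h2 : (2 : ℚ⟦X⟧) = PowerSeries.C 2 := (map_ofNat PowerSeries.C 2).symm
  have hexp : PowerSeries.C (p : ℚ) * ((1 - PowerSeries.X) * d⁄dX ℚ H -
        PowerSeries.C ((M : ℚ) + 2) * H) -
        PowerSeries.X * (1 - PowerSeries.X) * d⁄dX ℚ (d⁄dX ℚ H) +
        PowerSeries.C 2 * PowerSeries.C ((M : ℚ) + 2) * (PowerSeries.X * d⁄dX ℚ H) =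
      PowerSeries.C (p : ℚ) * (d⁄dX ℚ H - PowerSeries.X * d⁄dX ℚ H -
        PowerSeries.C ((M : ℚ) + 2) * H) - PowerSeries.X * d⁄dX ℚ (d⁄dX ℚ H) +
        PowerSeries.X ^ 2 * d⁄dX ℚ (d⁄dX ℚ H) +
        PowerSeries.C 2 * (PowerSeries.C ((M : ℚ) + 2) * (PowerSeries.X * d⁄dX ℚ H)) := by
    ring
  rw [hM, h2, hexp]
  ext k
  have key : ((k : ℚ) + 1) * (p - k) * hypCoeff p M (k + 1) -
      (k * ((p : ℚ) + 1 - k) - (M + 2) * (2 * k - p)) * hypCoeff p M k =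
      p * (M + 1) * hypCoeff p M p * if k = p then 1 else 0 := by
    split_ifs with h
    · subst h; ring
    · rw [hypCoeff_succ p M k h]; ring
  rw [PowerSeries.coeff_C_mul, PowerSeries.coeff_X_pow, ← key]
  rw [map_add, map_add, map_sub, PowerSeries.coeff_C_mul, map_sub, map_sub,
    PowerSeries.coeff_C_mul, PowerSeries.coeff_C_mul, PowerSeries.coeff_C_mul,
    coeff_X_sq_mul_derivative_derivative, coeff_X_mul_derivative, coeff_X_mul_derivative,
    PowerSeries.coeff_derivative, hH, PowerSeries.coeff_mk, PowerSeries.coeff_mk]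
  ring

/-- Closed form at the endpoint of the solution of a second-order difference equation. -/
lemma endpoint_eq_hypCoeff (p M : ℕ) (t : ℚ) (ht : t = -((M + 2) * (M + 1))) (A : ℕ → ℚ)
    (hA1 : A 1 = 0) (hA2 : A 2 = t)
    (hA : ∀ k, 1 ≤ k → k < p →
      A (k + 2) - 2 * A (k + 1) + A k = t * (1 / (k * ((p : ℚ) + 1 - k))) * A k) (hp : 1 ≤ p) :
    A (p + 1) = - (p * (M + 1) * hypCoeff p M p) := by
  set H : ℚ⟦X⟧ := PowerSeries.mk (hypCoeff p M) with hH
  set B : ℚ⟦X⟧ := PowerSeries.X ^ 2 * ((1 - PowerSeries.X) ^ M * H) with hB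
  have hode := euler_mul_pow p M H
  rw [hypergeometric_equation] at hode
  have hMt : ((M : ℚ⟦X⟧) + 2) * ((M : ℚ⟦X⟧) + 1) = PowerSeries.C (-t) := by
    rw [ht, neg_neg, map_mul, map_add, map_add, map_natCast, map_ofNat, map_one]
  rw [hMt] at hode
  have hcoef (k : ℕ) : (k : ℚ) * ((p : ℚ) + 1 - k) *
      (PowerSeries.coeff (k + 2) B - 2 * PowerSeries.coeff (k + 1) B + PowerSeries.coeff k B) -
      t * PowerSeries.coeff k B = PowerSeries.coeff k (PowerSeries.X ^ (p + 1) *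
        (PowerSeries.C (p * (M + 1) * hypCoeff p M p) * (1 - PowerSeries.X) ^ (M + 1))) := by
    have h := congrArg (PowerSeries.coeff k) hode
    rw [map_add, coeff_euler, PowerSeries.coeff_C_mul, 
      show (1 - PowerSeries.X) ^ (M + 2) * H = (1 - PowerSeries.X) ^ 2 *
        ((1 - PowerSeries.X) ^ M * H) by ring, coeff_second_difference] at h
    rw [hB, show ∀ a b : ℚ, a - t * b = a + -t * b by intros; ring, h]
    congr 1
    ring
  have hB1 : PowerSeries.coeff 1 B = 0 := by simp [hB, PowerSeries.coeff_X_pow_mul']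
  have hB2 : PowerSeries.coeff 2 B = 1 := by
    simp [hB, PowerSeries.coeff_X_pow_mul', hH, hypCoeff]
  clear_value B
  have hBA : ∀ k, k + 2 ≤ p + 1 → A (k + 1) = t * PowerSeries.coeff (k + 1) B ∧
      A (k + 2) = t * PowerSeries.coeff (k + 2) B := by
    intro k
    induction k with
    | zero =>
      intro _
      simp [hA1, hA2, hB1, hB2]
    | succ k ih =>
      intro hk
      obtain ⟨h1, h2⟩ := ih (by lia)
      refine ⟨h2, ?_⟩
      have hr := hA (k + 1) (by lia) (by lia)
      have hc := hcoef (k + 1)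
      rw [PowerSeries.coeff_X_pow_mul', if_neg (by lia)] at hc
      have hne1 : ((k + 1 : ℕ) : ℚ) ≠ 0 := by positivity
      have hne2 : (p : ℚ) + 1 - (k + 1 : ℕ) ≠ 0 := by
        rw [sub_ne_zero]; exact_mod_cast (by lia : p + 1 ≠ k + 1)
      rw [h1, show k + 1 + 1 = k + 2 from rfl, h2] at hr
      rw [show k + 1 + 1 = k + 2 from rfl] at hc
      have hc2 : PowerSeries.coeff (k + 1 + 2) B - 2 * PowerSeries.coeff (k + 2) B +
          PowerSeries.coeff (k + 1) B = t * (1 / (((k + 1 : ℕ) : ℚ) * ((p : ℚ) + 1 - (k + 1 : ℕ)))) *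
          PowerSeries.coeff (k + 1) B := by
        field_simp
        linear_combination hc
      linear_combination hr - t * hc2
  have hend := hcoef (p + 1)
  rw [PowerSeries.coeff_X_pow_mul', if_pos le_rfl, Nat.sub_self] at hend
  obtain ⟨k, rfl⟩ : ∃ k, p = k + 1 := ⟨p - 1, by lia⟩
  rw [(hBA k (by lia)).2]
  simp at hend
  push_cast
  rw [show k + 2 = k + 1 + 1 from rfl]
  linear_combination -hend
end

lemma hypCoeff_eq_prod (k M : ℕ) :
    ((k : ℚ) + 1) * (M + 1) * hypCoeff (k + 1) M (k + 1) = (M + 2) * (M + 1) * (k + 1) *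
      ∏ i ∈ range k, (1 - (M + 2) * (2 * (i + 1) - ((k : ℚ) + 1)) / ((i + 1) * (k + 1 - i))) := by
  have hnum : ∀ i ∈ range k, ((i + 1 : ℕ) * (((k + 1 : ℕ) : ℚ) + 1 - (i + 1 : ℕ)) -
      (M + 2) * (2 * (i + 1 : ℕ) - (k + 1 : ℕ))) =
      ((i + 1) * (k + 1 - i)) *
      (1 - (M + 2) * (2 * (i + 1) - ((k : ℚ) + 1)) / ((i + 1) * (k + 1 - i))) := by
    intro i hi
    have h2 : (k : ℚ) + 1 - i ≠ 0 := by
      rw [sub_ne_zero]; exact_mod_cast (by have := mem_range.1 hi; lia : k + 1 ≠ i)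
    have h1 : (i : ℚ) + 1 ≠ 0 := by positivity
    push_cast
    field_simp
    ring
  have hd : ∏ i ∈ range (k + 1), (((i : ℚ) + 1) * ((k + 1 : ℕ) - i)) =
      (k + 1) * ∏ i ∈ range k, (((i : ℚ) + 1) * (k + 1 - i)) := by
    rw [prod_range_succ]
    push_cast
    ring
  have hpos : ∏ i ∈ range k, (((i : ℚ) + 1) * (k + 1 - i)) ≠ 0 := by
    refine prod_ne_zero_iff.2 fun i hi => mul_ne_zero (by positivity) ?_
    rw [sub_ne_zero]; exact_mod_cast (by have := mem_range.1 hi; lia : k + 1 ≠ i)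
  rw [hypCoeff, prod_div_distrib, hd, prod_range_succ', prod_congr rfl hnum, prod_mul_distrib]
  have h1 : (k : ℚ) + 1 ≠ 0 := by positivity
  push_cast
  field_simp
  ring

/-- The endpoint value of the recurrence as a product over half of the range. -/
lemma endpoint_eq_prod (k M : ℕ) (t : ℚ) (ht : t = -((M + 2) * (M + 1))) (A : ℕ → ℚ)
    (hA1 : A 1 = 0) (hA2 : A 2 = t)
    (hA : ∀ j, 1 ≤ j → j ≤ k →
      A (j + 2) - 2 * A (j + 1) + A j = t * (1 / (j * ((k : ℚ) + 2 - j))) * A j) :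
    A (k + 2) = t * (k + 1) * ∏ i ∈ range (k / 2), (1 + t *
      (((k : ℚ) - 1 - 2 * i) ^ 2 / (((i + 1) * (k + 1 - i)) * ((i + 2) * (k - i))))) := by
  have h := endpoint_eq_hypCoeff (k + 1) M t ht A hA1 hA2 (fun j h1 h2 => by
    rw [hA j h1 (by lia)]; push_cast; ring_nf) (by lia)
  rw [h]
  push_cast
  rw [hypCoeff_eq_prod, prod_range_eq_prod_range_half _ _ k _ _, ht]
  · ring
  · intro i hi
    have hc : ((k - 1 - i : ℕ) : ℚ) = k - 1 - i := by
      rw [Nat.sub_sub, Nat.cast_sub (by lia)]; push_cast; ring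
    have h1 : (i : ℚ) + 1 ≠ 0 := by positivity
    have h2 : (i : ℚ) + 2 ≠ 0 := by positivity
    have h3 : (k : ℚ) + 1 - i ≠ 0 := by
      rw [sub_ne_zero]; exact_mod_cast (by lia : k + 1 ≠ i)
    have h4 : (k : ℚ) - i ≠ 0 := by
      rw [sub_ne_zero]; exact_mod_cast (by lia : k ≠ i)
    rw [hc, show (k : ℚ) - 1 - i + 1 = k - i by ring,
      show (k : ℚ) + 1 - (k - 1 - i) = i + 2 by ring]
    field_simp
    ring
  · rintro i rfl
    push_cast
    ring

lemma sum_composition_eq_sum_cons (k : ℕ) (hk : 1 ≤ k) (f : List ℕ → ℚ) :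
    ∑ c : Composition k, f c.blocks =
      ∑ j ∈ range k, ∑ c : Composition j, f ((k - j) :: c.blocks) := by
  rw [Finset.sum_sigma']
  symm
  refine Finset.sum_bij
    (fun x hx => ⟨(k - x.1) :: x.2.blocks, ?_, ?_⟩) ?_ ?_ ?_ ?_
  · intro i hi
    have hx1 := mem_range.1 (mem_sigma.1 hx).1
    rcases List.mem_cons.1 hi with rfl | h
    · lia
    · exact x.2.blocks_pos h
  · have hx1 := mem_range.1 (mem_sigma.1 hx).1
    rw [List.sum_cons, x.2.blocks_sum]
    lia
  · simp
  · rintro ⟨j, c⟩ hx ⟨i, d⟩ hy h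
    have hb := congrArg Composition.blocks h
    simp only [List.cons.injEq] at hb
    obtain rfl : j = i := by rw [← c.blocks_sum, ← d.blocks_sum, hb.2]
    rw [Composition.ext hb.2]
  · rintro ⟨b, hpos, hsum⟩ -
    cases b with
    | nil => simp at hsum; lia
    | cons a b =>
      have ha : 0 < a := hpos (by simp)
      rw [List.sum_cons] at hsum
      refine ⟨⟨b.sum, ⟨b, fun h => hpos (by simp [h]), rfl⟩⟩, ?_, ?_⟩
      · simp; lia
      · ext1
        simp; lia
  · intros; rfl

/-- The product of `a - 1` over the parts `a` and of `y s` over the sums `s` of the proper suffixes,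
the empty one included. -/
def pathWeight (y : ℕ → ℚ) : List ℕ → ℚ
  | [] => 1
  | a :: p => ((a : ℚ) - 1) * y p.sum * pathWeight y p

lemma sum_pathWeight_recurrence (y : ℕ → ℚ) (t : ℚ) (k : ℕ) (hk : 1 ≤ k) :
    ∑ c : Composition k, pathWeight y c.blocks * t ^ c.length =
      t * ∑ j ∈ range k, ((k : ℚ) - j - 1) *
        (y j * ∑ c : Composition j, pathWeight y c.blocks * t ^ c.length) := by
  have h := sum_composition_eq_sum_cons k hk (fun p => pathWeight y p * t ^ p.length)
  simp only [Composition.blocks_length] at h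
  rw [h, mul_sum]
  refine sum_congr rfl fun j hj => ?_
  rw [mul_sum, mul_sum, mul_sum]
  refine sum_congr rfl fun c _ => ?_
  rw [pathWeight, c.blocks_sum, List.length_cons, c.blocks_length,
    Nat.cast_sub (mem_range.1 hj).le]
  ring

lemma second_difference_of_convolution (y A : ℕ → ℚ) (t : ℚ)
    (hA : ∀ k, 1 ≤ k → A k = t * ∑ j ∈ range k, ((k : ℚ) - j - 1) * (y j * A j)) (k : ℕ)
    (hk : 1 ≤ k) : A (k + 2) - 2 * A (k + 1) + A k = t * y k * A k := by
  have hlin (a b c : ℚ) : (∑ j ∈ range k, (a - j - 1) * (y j * A j)) -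
      2 * (∑ j ∈ range k, (b - j - 1) * (y j * A j)) + ∑ j ∈ range k, (c - j - 1) * (y j * A j) =
      (a - 2 * b + c) * ∑ j ∈ range k, y j * A j := by
    rw [mul_sum, mul_sum, ← sum_sub_distrib, ← sum_add_distrib]
    exact sum_congr rfl fun j _ => by ring
  have h := hlin (k + 2) (k + 1) k
  have h2 := hA (k + 2) (by lia)
  have h1 := hA (k + 1) (by lia)
  have h0 := hA k hk
  rw [sum_range_succ, sum_range_succ] at h2
  rw [sum_range_succ] at h1
  push_cast at h2 h1
  linear_combination h2 - 2 * h1 + h0 + t * h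

lemma Rval_cons (a : ℕ) (p : List ℕ) : Rval (a :: p) = ((a + p.sum : ℕ) : ℚ) * Rval p := by
  rw [Rval, Rval, Lval, Lval, List.reverse_cons, List.length_append, List.length_singleton,
    prod_range_succ, mul_comm]
  congr 1
  · rw [List.take_of_length_le (by simp)]
    simp [add_comm]
  · refine prod_congr rfl fun j hj => ?_
    rw [List.take_append_of_le_length (by have := mem_range.1 hj; lia)]

lemma prod_offset_cons (s a : ℕ) (p : List ℕ) :
    ∏ j ∈ range (a :: p).length, ((s + ((a :: p).take (j + 1)).sum : ℕ) : ℚ) =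
      ((s + a : ℕ) : ℚ) * ∏ j ∈ range p.length, ((s + a + (p.take (j + 1)).sum : ℕ) : ℚ) := by
  rw [List.length_cons, prod_range_succ', mul_comm]
  simp only [List.take_succ_cons, List.sum_cons, List.take_zero, List.sum_nil, add_zero,
    ← add_assoc]

/-- With `y 0 = 1`, the weights `y s = 1 / (s * (n - s))` collect the product of all
left and right partial sums. -/
lemma prod_sub_one_div_eq (n : ℕ) (y : ℕ → ℚ) (hy0 : y 0 = 1)
    (hy : ∀ j, 1 ≤ j → y j = 1 / (j * ((n : ℚ) - j))) (p : List ℕ) (hp : ∀ a ∈ p, 0 < a)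
    (hne : p ≠ []) (s : ℕ) (hs : s + p.sum = n) :
    (p.map (fun i : ℕ => (i : ℚ) - 1)).prod /
        ((∏ j ∈ range p.length, ((s + (p.take (j + 1)).sum : ℕ) : ℚ)) * Rval p) =
      pathWeight y p / (n * p.sum) := by
  induction p generalizing s with
  | nil => exact absurd rfl hne
  | cons a p ih =>
    rw [List.map_cons, List.prod_cons, prod_offset_cons, Rval_cons, pathWeight, List.sum_cons]
    rw [List.sum_cons] at hs
    by_cases hp0 : p = []
    · subst hp0
      simp only [List.sum_nil, add_zero] at hs
      simp [hy0, pathWeight, Rval, Lval, hs]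
    · have h := ih (fun b hb => hp b (List.mem_cons_of_mem _ hb)) hp0 (s + a) (by lia)
      have hsum : 1 ≤ p.sum := by
        cases p with
        | nil => exact absurd rfl hp0
        | cons b p => have := hp b (by simp); simp; lia
      have hsa : ((s + a : ℕ) : ℚ) = n - p.sum := by
        rw [← hs]; push_cast; ring
      calc _ = ((a : ℚ) - 1) / (((s + a : ℕ) : ℚ) * (a + p.sum : ℕ)) *
            ((p.map (fun i : ℕ => (i : ℚ) - 1)).prod / ((∏ j ∈ range p.length,
              ((s + a + (p.take (j + 1)).sum : ℕ) : ℚ)) * Rval p)) := by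
              rw [div_mul_div_comm]; congr 1; ring
        _ = _ := by
              rw [h, hy _ hsum, hsa]
              simp only [div_eq_mul_inv, mul_inv, one_mul]
              ring

lemma composition_summand_eq (n : ℕ) (hn : 1 ≤ n) (y : ℕ → ℚ) (hy0 : y 0 = 1)
    (hy : ∀ j, 1 ≤ j → y j = 1 / (j * ((n : ℚ) - j))) (c : Composition n) :
    (c.blocks.map (fun i : ℕ => (i : ℚ) - 1)).prod / (Lval c.blocks * Rval c.blocks) =
      pathWeight y c.blocks / (n : ℚ) ^ 2 := by
  have hne : c.blocks ≠ [] := by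
    intro h
    have := c.blocks_sum
    rw [h, List.sum_nil] at this
    lia
  have h := prod_sub_one_div_eq n y hy0 hy c.blocks (fun _ => c.blocks_pos) hne 0
    (by rw [zero_add, c.blocks_sum])
  rw [c.blocks_sum, ← pow_two] at h
  simpa only [zero_add, Lval] using h

lemma sum_pathWeight_polynomial_eq (k : ℕ) (y : ℕ → ℚ) (hy0 : y 0 = 1)
    (hy : ∀ j, 1 ≤ j → y j = 1 / (j * ((k : ℚ) + 2 - j))) :
    ∑ c : Composition (k + 2), Polynomial.C (pathWeight y c.blocks) * Polynomial.X ^ c.length =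
      Polynomial.X * (Polynomial.C ((k : ℚ) + 1) * ∏ i ∈ range (k / 2), (1 + Polynomial.C
        (((k : ℚ) - 1 - 2 * i) ^ 2 / (((i + 1) * (k + 1 - i)) * ((i + 2) * (k - i)))) *
          Polynomial.X)) := by
  apply Polynomial.eq_of_infinite_eval_eq
  refine Set.infinite_of_injective_forall_mem (f := fun M : ℕ => -(((M : ℚ) + 2) * (M + 1))) ?_ ?_
  · intro M N h
    have hmul : ((M : ℚ) - N) * (M + N + 3) = 0 := by
      simp only at h
      linear_combination -h
    have hpos : (M : ℚ) + N + 3 ≠ 0 := by positivity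
    exact_mod_cast sub_eq_zero.1 ((mul_eq_zero.1 hmul).resolve_right hpos)
  · intro M
    set t : ℚ := -(((M : ℚ) + 2) * (M + 1)) with ht
    have hrec := sum_pathWeight_recurrence y t
    have h0 : ∑ c : Composition 0, pathWeight y c.blocks * t ^ c.length = 1 := by
      have hnil (c : Composition 0) : c.blocks = [] :=
        List.length_eq_zero_iff.1 (Nat.le_zero.1 c.length_le)
      simp [Composition.length, hnil, pathWeight, composition_card]
    set A : ℕ → ℚ := fun j => ∑ c : Composition j, pathWeight y c.blocks * t ^ c.length with hA
    have hA1 : A 1 = 0 := by simp [hA, hrec 1 le_rfl]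
    have hA2 : A 2 = t := by
      have h := hrec 2 (by lia)
      simp only [sum_range_succ, range_zero, sum_empty, h0, hy0] at h
      simp only [hA, h]
      norm_num
    have h := endpoint_eq_prod k M t ht A hA1 hA2 (fun j h1 _ => by
      rw [second_difference_of_convolution y A t hrec j h1, hy j h1])
    simp only [Set.mem_ofPred_eq, Polynomial.eval_finsetSum, Polynomial.eval_mul,
      Polynomial.eval_C, Polynomial.eval_pow, Polynomial.eval_X, Polynomial.eval_prod,
      Polynomial.eval_add, Polynomial.eval_one]
    refine h.trans ?_
    simp only [mul_comm t, mul_assoc]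

/-- Identity (2): for `n ≥ 2`, `m = ⌊n/2⌋` and `1 ≤ l ≤ n`,
`∑ (p₁-1)⋯(p_l-1)/(L(p)R(p)) = ((n-1)/n²) · e_{l-1}(r₁/(q₁q₂), …, r_{m-1}/(q_{m-1}q_m))`,
the sum over all `l`-compositions of `n`, where `q_i = i(n-i)` and `r_i = (n-1-2i)²`. -/
theorem composition_sum_prod_parts_sub_one (n : ℕ) (hn : 2 ≤ n) (m : ℕ) (hm : m = n / 2)
    (l : ℕ) (hl : 1 ≤ l) (hln : l ≤ n)
    (q r : ℕ → ℚ)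
    (hq : ∀ i, q i = (i : ℚ) * ((n : ℚ) - i))
    (hr : ∀ i, r i = ((n : ℚ) - 1 - 2 * i) ^ 2) :
    (∑ c ∈ Finset.univ.filter (fun c : Composition n => c.length = l),
        (c.blocks.map (fun i : ℕ => (i : ℚ) - 1)).prod / (Lval c.blocks * Rval c.blocks)) =
      (((n : ℚ) - 1) / (n : ℚ) ^ 2) *
        ((Finset.Icc 1 (m - 1)).val.map
            (fun i : ℕ => r i / (q i * q (i + 1)))).esymm (l - 1) := by
  obtain ⟨k, rfl⟩ : ∃ k, n = k + 2 := ⟨n - 2, by lia⟩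
  obtain ⟨l, rfl⟩ : ∃ j, l = j + 1 := ⟨l - 1, by lia⟩
  set y : ℕ → ℚ := fun j => if j = 0 then 1 else 1 / (j * ((k : ℚ) + 2 - j)) with hy
  have hy0 : y 0 = 1 := by simp [hy]
  have hy1 : ∀ j, 1 ≤ j → y j = 1 / (j * ((k : ℚ) + 2 - j)) := fun j hj => by
    simp [hy, Nat.one_le_iff_ne_zero.1 hj]
  have hprod : ∏ i ∈ Icc 1 (m - 1),
      (1 + Polynomial.C (r i / (q i * q (i + 1))) * Polynomial.X) =
      ∏ i ∈ range (k / 2), (1 + Polynomial.C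
        (((k : ℚ) - 1 - 2 * i) ^ 2 / (((i + 1) * (k + 1 - i)) * ((i + 2) * (k - i)))) *
          Polynomial.X) := by
    rw [show Icc 1 (m - 1) = Ico 1 (k / 2 + 1) by ext i; simp; lia,
      prod_Ico_eq_prod_range, Nat.add_sub_cancel]
    refine prod_congr rfl fun i _ => ?_
    rw [hq, hq, hr]
    push_cast
    ring_nf
  have hcoeff := congrArg (Polynomial.coeff · (l + 1)) (sum_pathWeight_polynomial_eq k y hy0 hy1)
  simp only [Polynomial.finsetSum_coeff, Polynomial.coeff_X_mul, Polynomial.coeff_C_mul,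
    Polynomial.coeff_X_pow, mul_ite, mul_one, mul_zero] at hcoeff
  rw [← hprod, coeff_prod_one_add_C_mul_X] at hcoeff
  rw [Nat.add_sub_cancel, sum_congr rfl fun c _ => composition_summand_eq (k + 2) (by lia) y hy0
    (by simpa using hy1) c, ← sum_div, sum_filter]
  simp only [eq_comm (a := l + 1)] at hcoeff
  rw [hcoeff]
  push_cast
  ring
end

section
/- Let K = ℚ(u,v) be the field of rational functions in two variables and work in the rational function field K(γ). Define f_0 = 1 and, for n ≥ 1, f_n ∈ K(γ) by the recurrence n(γ−n) f_n = Σ_{i=0}^{n−1} ((n−i)u + v) f_i. Then for every n ≥ 1 the rational function (γ−n)·f_n has no pole at γ = n, and its value at γ = n equals n · P_n(u,v); that is, the residue of f_n at its (simple) pole γ = n equals n · P_n(u,v). -/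
open Finset MvPolynomial

/-- The rational function `r` is regular at `a` and takes the value `b` there. -/
def RatFunc.HasValueAt {K : Type*} [Field K] (r : RatFunc K) (a b : K) : Prop :=
  ∃ p q : Polynomial K, q.eval a ≠ 0 ∧
    r * algebraMap _ (RatFunc K) q = algebraMap _ (RatFunc K) p ∧ p.eval a = b * q.eval a

namespace RatFunc.HasValueAt

variable {K : Type*} [Field K] {r s : RatFunc K} {a b c : K}

theorem const (a b : K) : (RatFunc.C b).HasValueAt a b :=
  ⟨Polynomial.C b, 1, by simp, by simp, by simp⟩

theorem add (hr : r.HasValueAt a b) (hs : s.HasValueAt a c) : (r + s).HasValueAt a (b + c) := by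
  obtain ⟨p, q, hq, h, hp⟩ := hr
  obtain ⟨p', q', hq', h', hp'⟩ := hs
  refine ⟨p * q' + p' * q, q * q', by simp [hq, hq'], ?_, ?_⟩
  · simp only [map_mul, map_add, ← h, ← h']
    ring
  · simp only [Polynomial.eval_add, Polynomial.eval_mul, hp, hp']
    ring

theorem mul (hr : r.HasValueAt a b) (hs : s.HasValueAt a c) : (r * s).HasValueAt a (b * c) := by
  obtain ⟨p, q, hq, h, hp⟩ := hr
  obtain ⟨p', q', hq', h', hp'⟩ := hs
  refine ⟨p * p', q * q', by simp [hq, hq'], ?_, ?_⟩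
  · simp only [map_mul, ← h, ← h']
    ring
  · simp only [Polynomial.eval_mul, hp, hp']
    ring

theorem sum {ι : Type*} {t : Finset ι} {f : ι → RatFunc K} {g : ι → K}
    (h : ∀ i ∈ t, (f i).HasValueAt a (g i)) : (∑ i ∈ t, f i).HasValueAt a (∑ i ∈ t, g i) := by
  classical
  induction t using Finset.induction_on with
  | empty => simpa using const a (0 : K)
  | insert i t hi ih =>
    rw [Finset.sum_insert hi, Finset.sum_insert hi]
    exact (h i (by simp)).add (ih fun j hj => h j (by simp [hj]))

theorem of_algebraMap_mul {d : Polynomial K} (hd : d.eval a ≠ 0)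
    (h : (algebraMap _ (RatFunc K) d * r).HasValueAt a b) : r.HasValueAt a (b / d.eval a) := by
  obtain ⟨p, q, hq, h, hp⟩ := h
  refine ⟨p, d * q, by simp [hq, hd], ?_, ?_⟩
  · rw [map_mul, ← h]
    ring
  · rw [hp, Polynomial.eval_mul]
    field_simp

theorem denom_eval_ne_zero (h : r.HasValueAt a b) : r.denom.eval a ≠ 0 := by
  obtain ⟨p, q, hq, h, -⟩ := h
  have hq0 : q ≠ 0 := by rintro rfl; simp at hq
  have hdvd : r.denom ∣ q :=
    (RatFunc.denom_dvd hq0).2 ⟨p, (eq_div_iff (RatFunc.algebraMap_ne_zero hq0)).2 h⟩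
  obtain ⟨t, rfl⟩ := hdvd
  exact fun h0 => hq (by simp [h0])

theorem eval_eq (h : r.HasValueAt a b) : RatFunc.eval (RingHom.id K) a r = b := by
  have hden := h.denom_eval_ne_zero
  obtain ⟨p, q, hq, h, hp⟩ := h
  have key : r.num * q = p * r.denom := by
    apply RatFunc.algebraMap_injective K
    have := RatFunc.num_div_denom r
    rw [div_eq_iff (RatFunc.algebraMap_ne_zero r.denom_ne_zero)] at this
    rw [map_mul, map_mul, ← h, this]
    ring
  have key' := congrArg (Polynomial.eval a) key
  rw [Polynomial.eval_mul, Polynomial.eval_mul, hp] at key'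
  simp only [RatFunc.eval, Polynomial.eval₂_id]
  rw [div_eq_iff hden]
  exact mul_right_cancel₀ hq (by rw [key']; ring)

end RatFunc.HasValueAt

theorem Multiset.esymm_map_mul_right {R : Type*} [CommSemiring R] (s : Multiset R) (a : R)
    (k : ℕ) : (s.map fun x => x * a).esymm k = s.esymm k * a ^ k := by
  rw [Multiset.esymm, Multiset.esymm, Multiset.powersetCard_map, Multiset.map_map,
    ← Multiset.sum_map_mul_right]
  refine congrArg Multiset.sum (Multiset.map_congr rfl fun t ht => ?_)
  rw [Multiset.mem_powersetCard] at ht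
  simp [Multiset.prod_map_mul, ht.2]

theorem Multiset.esymm_map_ringHom {R S : Type*} [CommSemiring R] [CommSemiring S] (φ : R →+* S)
    (s : Multiset R) (k : ℕ) : (s.map φ).esymm k = φ (s.esymm k) := by
  rw [Multiset.esymm, Multiset.esymm, Multiset.powersetCard_map, Multiset.map_map,
    map_multiset_sum, Multiset.map_map]
  refine congrArg Multiset.sum (Multiset.map_congr rfl fun t _ => ?_)
  simp [map_multiset_prod]

/-- Homogeneous form of Vieta's formula. -/
theorem Multiset.prod_map_mul_add_eq_sum_esymm {R : Type*} [CommSemiring R] (s : Multiset R)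
    (u v : R) : (s.map fun x => x * u + v).prod =
      ∑ k ∈ Finset.range (Multiset.card s + 1), s.esymm k * u ^ k * v ^ (Multiset.card s - k) := by
  have h := congrArg (Polynomial.eval v)
    (Multiset.prod_X_add_C_eq_sum_esymm (s.map fun x => x * u))
  simpa [Polynomial.eval_multiset_prod, Multiset.map_map, Polynomial.eval_finsetSum,
    Multiset.esymm_map_mul_right, add_comm v] using h

/-- The composition of `n` obtained from a composition of `i < n` by adding a last block. -/
def Composition.snoc {n i : ℕ} (c : Composition i) (hi : i < n) : Composition n where
  blocks := c.blocks ++ [n - i]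
  blocks_pos := by
    intro j hj
    rcases List.mem_append.1 hj with hj | hj
    · exact c.blocks_pos hj
    · rw [List.mem_singleton.1 hj]
      omega
  blocks_sum := by
    rw [List.sum_append, c.blocks_sum, List.sum_singleton]
    omega

theorem Composition.sum_eq_sum_snoc {M : Type*} [AddCommMonoid M] {n : ℕ} (hn : 1 ≤ n)
    (g : List ℕ → M) : ∑ c : Composition n, g c.blocks =
      ∑ i ∈ Finset.range n, ∑ c : Composition i, g (c.blocks ++ [n - i]) := by
  rw [Finset.sum_sigma']
  symm
  refine Finset.sum_bij
    (fun x hx => x.2.snoc (Finset.mem_range.1 (Finset.mem_sigma.1 hx).1)) ?_ ?_ ?_ ?_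
  · intros
    exact Finset.mem_univ _
  · rintro ⟨i, c⟩ hi ⟨j, d⟩ hj h
    have h' : c.blocks ++ [n - i] = d.blocks ++ [n - j] := congrArg Composition.blocks h
    have hb := (List.append_inj' h' rfl).1
    obtain rfl : i = j := by rw [← c.blocks_sum, hb, d.blocks_sum]
    rw [Composition.ext hb]
  · intro c _
    have hne : c.blocks ≠ [] := by
      intro h
      have := c.blocks_sum
      rw [h, List.sum_nil] at this
      omega
    have hsplit := List.dropLast_append_getLast hne
    have hpos := c.blocks_pos (List.getLast_mem hne)
    have hsum : c.blocks.dropLast.sum + c.blocks.getLast hne = n := by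
      conv_rhs => rw [← c.blocks_sum, ← hsplit]
      simp
    refine ⟨⟨c.blocks.dropLast.sum,
      ⟨c.blocks.dropLast, fun hj => c.blocks_pos (List.mem_of_mem_dropLast hj), rfl⟩⟩, ?_, ?_⟩
    · simp only [Finset.mem_sigma, Finset.mem_range, Finset.mem_univ, and_true]
      omega
    · apply Composition.ext
      change c.blocks.dropLast ++ [n - c.blocks.dropLast.sum] = c.blocks
      conv_rhs => rw [← hsplit]
      congr 2
      omega
  · intros
    rfl

theorem Lval_append_singleton (p : List ℕ) (m : ℕ) :
    Lval (p ++ [m]) = Lval p * ((p.sum + m : ℕ) : ℚ) := by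
  rw [Lval, Lval, List.length_append, List.length_singleton, Finset.prod_range_succ]
  congr 1
  · refine Finset.prod_congr rfl fun j hj => ?_
    rw [List.take_append_of_le_length (Finset.mem_range.1 hj)]
  · rw [List.take_of_length_le (by simp)]
    simp

theorem Rval_eq_prod (p : List ℕ) :
    Rval p = ∏ j ∈ Finset.range p.length, ((p.sum : ℚ) - ((p.take j).sum : ℕ)) := by
  rw [Rval, Lval, List.length_reverse, ← Finset.prod_range_reflect]
  refine Finset.prod_congr rfl fun j hj => ?_
  have hj := Finset.mem_range.1 hj
  have h := List.sum_take_add_sum_drop p j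
  rw [List.take_reverse, List.sum_reverse, show p.length - (p.length - 1 - j + 1) = j by omega,
    ← h]
  push_cast
  ring

theorem Rval_append_singleton (p : List ℕ) (m : ℕ) :
    Rval (p ++ [m]) = ((p.sum + m : ℕ) : ℚ) *
      ∏ j ∈ Finset.range p.length,
        (((p.sum + m : ℕ) : ℚ) - ((p.take (j + 1)).sum : ℕ)) := by
  rw [Rval_eq_prod, List.length_append, List.length_singleton, Finset.prod_range_succ', mul_comm]
  congr 1
  · simp
  · refine Finset.prod_congr rfl fun j hj => ?_
    rw [List.take_append_of_le_length (Finset.mem_range.1 hj)]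
    simp

section ChainWeight

variable {K : Type*} [Field K]

/-- The contribution of the chain of partial sums of `p` to the value at `γ = N` of the solution
of the recurrence. -/
def chainWeight (u v : K) (N : ℕ) (p : List ℕ) : K :=
  (p.map fun x : ℕ => (x : K) * u + v).prod /
    ∏ j ∈ Finset.range p.length,
      (((p.take (j + 1)).sum : ℕ) : K) * ((N : K) - ((p.take (j + 1)).sum : ℕ))

theorem chainWeight_append_singleton (u v : K) (N : ℕ) (p : List ℕ) (m : ℕ) :
    chainWeight u v N (p ++ [m]) = ((m : K) * u + v) * chainWeight u v N p /
      (((p.sum + m : ℕ) : K) * ((N : K) - ((p.sum + m : ℕ) : K))) := by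
  have hprod : ∏ j ∈ Finset.range p.length,
      ((((p ++ [m]).take (j + 1)).sum : ℕ) : K) * ((N : K) - (((p ++ [m]).take (j + 1)).sum : ℕ)) =
      ∏ j ∈ Finset.range p.length,
        (((p.take (j + 1)).sum : ℕ) : K) * ((N : K) - ((p.take (j + 1)).sum : ℕ)) := by
    refine Finset.prod_congr rfl fun j hj => ?_
    rw [List.take_append_of_le_length (Finset.mem_range.1 hj)]
  rw [chainWeight, chainWeight, List.length_append, List.length_singleton,
    Finset.prod_range_succ, hprod, List.take_of_length_le (by simp), List.map_append,
    List.prod_append, List.sum_append, List.sum_singleton, List.map_singleton,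
    List.prod_singleton, mul_div_assoc', div_div]
  ring

theorem sum_chainWeight_eq (u v : K) (N : ℕ) {n : ℕ} (hn : 1 ≤ n) :
    ∑ c : Composition n, chainWeight u v N c.blocks =
      (∑ i ∈ Finset.range n, (((n - i : ℕ) : K) * u + v) *
        ∑ c : Composition i, chainWeight u v N c.blocks) / ((n : K) * ((N : K) - n)) := by
  rw [Composition.sum_eq_sum_snoc hn, Finset.sum_div]
  refine Finset.sum_congr rfl fun i hi => ?_
  have hi := Finset.mem_range.1 hi
  rw [Finset.mul_sum, Finset.sum_div]
  refine Finset.sum_congr rfl fun c _ => ?_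
  rw [chainWeight_append_singleton, c.blocks_sum, Nat.add_sub_cancel' hi.le]

theorem prod_div_Lval_mul_Rval [CharZero K] (u v : K) {n i : ℕ} (hi : i < n)
    (c : Composition i) :
    ((c.blocks ++ [n - i]).map fun x : ℕ => (x : K) * u + v).prod /
      ((Lval (c.blocks ++ [n - i]) * Rval (c.blocks ++ [n - i]) : ℚ) : K) =
      (((n - i : ℕ) : K) * u + v) * chainWeight u v n c.blocks / ((n : K) * n) := by
  rw [Lval_append_singleton, Rval_append_singleton, c.blocks_sum, Nat.add_sub_cancel' hi.le,
    chainWeight, List.map_append, List.prod_append, List.map_singleton, List.prod_singleton,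
    Finset.prod_mul_distrib, Lval]
  simp only [Rat.cast_mul, Rat.cast_prod, Rat.cast_sub, Rat.cast_natCast]
  generalize (List.map (fun x : ℕ => (x : K) * u + v) c.blocks).prod = A
  rw [mul_div_assoc', div_div]
  ring

theorem map_Pgen [CharZero K] (φ : MvPolynomial (Fin 2) ℚ →+* K) {n : ℕ} (hn : 1 ≤ n) :
    φ (Pgen n) = ∑ c : Composition n,
      (c.blocks.map fun x : ℕ => (x : K) * φ (X 0) + φ (X 1)).prod /
        ((Lval c.blocks * Rval c.blocks : ℚ) : K) := by
  have hC (q : ℚ) : φ (C q) = (q : K) := eq_ratCast (φ.comp C) q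
  have hlen : ∀ c ∈ (Finset.univ : Finset (Composition n)), c.length ∈ Finset.Icc 1 n :=
    fun c _ => Finset.mem_Icc.2 ⟨c.length_pos_of_pos hn, c.length_le⟩
  rw [Pgen, map_sum, ← Finset.sum_fiberwise_of_maps_to hlen]
  refine Finset.sum_congr rfl fun l _ => ?_
  simp only [map_sum, map_mul, map_pow, hC, Sval, Finset.sum_mul]
  rw [Finset.sum_comm]
  refine Finset.sum_congr rfl fun c hc => ?_
  obtain rfl : c.length = l := (Finset.mem_filter.1 hc).2
  have h := Multiset.prod_map_mul_add_eq_sum_esymm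
    ((c.blocks : Multiset ℕ).map fun x : ℕ => (x : K)) (φ (X 0)) (φ (X 1))
  have hcast : (c.blocks : Multiset ℕ).map (fun x : ℕ => (x : K)) =
      ((c.blocks : Multiset ℕ).map fun x : ℕ => (x : ℚ)).map (Rat.castHom K) := by
    rw [Multiset.map_map]
    exact Multiset.map_congr rfl fun x _ => by simp
  rw [Multiset.card_map, Multiset.coe_card, Multiset.map_map] at h
  rw [show (c.blocks.map fun x : ℕ => (x : K) * φ (X 0) + φ (X 1)).prod = _ from h,
    Finset.sum_div]
  refine Finset.sum_congr rfl fun k _ => ?_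
  rw [hcast, Multiset.esymm_map_ringHom]
  simp only [Multiset.map_coe, Rat.coe_castHom, Rat.cast_div, Composition.length]
  ring

theorem hasValueAt_of_recurrence [CharZero K] (u v : K) (f : ℕ → RatFunc K) (hf0 : f 0 = 1)
    (hf : ∀ n : ℕ, 1 ≤ n → (n : RatFunc K) * (RatFunc.X - RatFunc.C (n : K)) * f n =
      ∑ i ∈ Finset.range n, RatFunc.C (((n - i : ℕ) : K) * u + v) * f i)
    (N n : ℕ) (hn : n < N) :
    (f n).HasValueAt (N : K) (∑ c : Composition n, chainWeight u v N c.blocks) := by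
  induction n using Nat.strong_induction_on with
  | _ n ih =>
    rcases Nat.eq_zero_or_pos n with rfl | hpos
    · have hone : ∑ c : Composition 0, chainWeight u v N c.blocks = 1 := by
        have hnil (c : Composition 0) : c.blocks = [] :=
          List.length_eq_zero_iff.1 (Nat.le_zero.1 c.length_le)
        rw [Fintype.sum_eq_single (Composition.ones 0) fun c hc =>
          (hc (Composition.ext ((hnil c).trans (hnil _).symm))).elim, hnil]
        simp [chainWeight]
      rw [hf0, hone]
      simpa using RatFunc.HasValueAt.const (N : K) 1
    · have hd : (Polynomial.C (n : K) * (Polynomial.X - Polynomial.C (n : K))).eval (N : K) =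
          (n : K) * ((N : K) - n) := by simp
      have hne : (n : K) * ((N : K) - n) ≠ 0 :=
        mul_ne_zero (Nat.cast_ne_zero.2 hpos.ne')
          (sub_ne_zero.2 (Nat.cast_injective.ne hn.ne'))
      rw [sum_chainWeight_eq u v N hpos, ← hd]
      refine RatFunc.HasValueAt.of_algebraMap_mul (by rwa [hd]) ?_
      have heq : algebraMap _ (RatFunc K)
          (Polynomial.C (n : K) * (Polynomial.X - Polynomial.C (n : K))) * f n =
          ∑ i ∈ Finset.range n, RatFunc.C (((n - i : ℕ) : K) * u + v) * f i := by
        rw [← hf n hpos]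
        simp
      rw [heq]
      refine RatFunc.HasValueAt.sum fun i hi => ?_
      have hi := Finset.mem_range.1 hi
      exact (RatFunc.HasValueAt.const _ _).mul (ih i hi (hi.trans hn))

theorem hasValueAt_residue [CharZero K] (φ : MvPolynomial (Fin 2) ℚ →+* K) (f : ℕ → RatFunc K)
    (hf0 : f 0 = 1)
    (hf : ∀ n : ℕ, 1 ≤ n → (n : RatFunc K) * (RatFunc.X - RatFunc.C (n : K)) * f n =
      ∑ i ∈ Finset.range n, RatFunc.C (((n - i : ℕ) : K) * φ (X 0) + φ (X 1)) * f i)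
    {n : ℕ} (hn : 1 ≤ n) :
    ((RatFunc.X - RatFunc.C (n : K)) * f n).HasValueAt (n : K) (n • φ (Pgen n)) := by
  have hn0 : (n : K) ≠ 0 := Nat.cast_ne_zero.2 (by omega)
  have hval : n • φ (Pgen n) =
      (∑ i ∈ Finset.range n, (((n - i : ℕ) : K) * φ (X 0) + φ (X 1)) *
        ∑ c : Composition i, chainWeight (φ (X 0)) (φ (X 1)) n c.blocks) /
        (Polynomial.C (n : K)).eval (n : K) := by
    rw [map_Pgen φ hn, Composition.sum_eq_sum_snoc hn fun p =>
      (p.map fun x : ℕ => (x : K) * φ (X 0) + φ (X 1)).prod / ((Lval p * Rval p : ℚ) : K),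
      Polynomial.eval_C, Finset.sum_div, nsmul_eq_mul, Finset.mul_sum]
    refine Finset.sum_congr rfl fun i hi => ?_
    rw [Finset.mul_sum, Finset.mul_sum, Finset.sum_div]
    refine Finset.sum_congr rfl fun c _ => ?_
    rw [prod_div_Lval_mul_Rval _ _ (Finset.mem_range.1 hi)]
    field_simp
  rw [hval]
  refine RatFunc.HasValueAt.of_algebraMap_mul (by simpa using hn0) ?_
  have heq : algebraMap _ (RatFunc K) (Polynomial.C (n : K)) *
      ((RatFunc.X - RatFunc.C (n : K)) * f n) =
      ∑ i ∈ Finset.range n, RatFunc.C (((n - i : ℕ) : K) * φ (X 0) + φ (X 1)) * f i := by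
    rw [← hf n hn, ← mul_assoc]
    simp
  rw [heq]
  exact RatFunc.HasValueAt.sum fun i hi => (RatFunc.HasValueAt.const _ _).mul
    (hasValueAt_of_recurrence _ _ f hf0 hf n i (Finset.mem_range.1 hi))

end ChainWeight

theorem FractionRing.natCast_rat_smul (m : ℕ) (x : FractionRing (MvPolynomial (Fin 2) ℚ)) :
    (m : ℚ) • x = m * x := by
  rw [← smul_one_smul (MvPolynomial (Fin 2) ℚ) (m : ℚ) x, Nat.cast_smul_eq_nsmul, nsmul_one,
    Algebra.smul_def, map_natCast]

/-- Proposition 2: over `K = ℚ(u,v)` (the fraction field of `ℚ[u,v]`), if `f₀ = 1` and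
`n(γ-n) f_n = ∑_{i=0}^{n-1} ((n-i)u + v) f_i` in `K(γ)` (with `γ = RatFunc.X`), then
`(γ-n)·f_n` has no pole at `γ = n` (its denominator does not vanish at `n`) and its
value there is `n · P_n(u,v)`; i.e. the residue of `f_n` at its simple pole `γ = n`
equals `n · P_n(u,v)`. -/
theorem residue_of_recurrence_solution
    (u v : FractionRing (MvPolynomial (Fin 2) ℚ))
    (hu : u = algebraMap (MvPolynomial (Fin 2) ℚ) _ (X 0))
    (hv : v = algebraMap (MvPolynomial (Fin 2) ℚ) _ (X 1))
    (f : ℕ → RatFunc (FractionRing (MvPolynomial (Fin 2) ℚ)))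
    (hf0 : f 0 = 1)
    (hf : ∀ n : ℕ, 1 ≤ n →
      (n : RatFunc (FractionRing (MvPolynomial (Fin 2) ℚ))) *
          (RatFunc.X - RatFunc.C ((n : ℕ) : FractionRing (MvPolynomial (Fin 2) ℚ))) * f n =
        ∑ i ∈ Finset.range n,
          RatFunc.C (((n : ℚ) - (i : ℚ)) • u + v) * f i) :
    ∀ n : ℕ, 1 ≤ n →
      ((RatFunc.X - RatFunc.C ((n : ℕ) : FractionRing (MvPolynomial (Fin 2) ℚ))) *
            f n).denom.eval ((n : ℕ) : FractionRing (MvPolynomial (Fin 2) ℚ)) ≠ 0 ∧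
      RatFunc.eval (RingHom.id _) ((n : ℕ) : FractionRing (MvPolynomial (Fin 2) ℚ))
          ((RatFunc.X - RatFunc.C ((n : ℕ) : FractionRing (MvPolynomial (Fin 2) ℚ))) * f n) =
        (n : ℕ) • algebraMap (MvPolynomial (Fin 2) ℚ) _ (Pgen n) := by
  intro n hn
  subst hu hv
  have h := hasValueAt_residue
    (algebraMap (MvPolynomial (Fin 2) ℚ) (FractionRing (MvPolynomial (Fin 2) ℚ))) f hf0
    (fun m hm => by
      rw [hf m hm]
      refine Finset.sum_congr rfl fun i hi => ?_
      rw [← Nat.cast_sub (Finset.mem_range.1 hi).le, FractionRing.natCast_rat_smul]) hn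
  exact ⟨h.denom_eval_ne_zero, h.eval_eq⟩
end
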